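/- arXiv:2510.11638 — 2 statements merged into one kernel-verified Lean document; each statement's English description precedes it below -/
import Mathlib

section
/- In Euclidean 4-space, let A, B, P, M be points with ‖A−B‖ = ε, ‖A−M‖ = ‖B−M‖ = ‖A−P‖ = ‖B−P‖ = c, and ‖P−M‖ = ℓ, where a ≤ b < c are side lengths of an obtuse triangle, 0 < ε < √Δ/a, and ℓ = √((Δ−a²ε²)/(b²−(ε/2)²)) with Δ = -a⁴-b⁴-c⁴+2a²b²+2b²c²+2c²a². Then there exists a point N in the affine span of {A,B,P,M} with ‖N−A‖ = ‖N−B‖ = b and ‖N−P‖ = ‖N−M‖ = a. -/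
theorem aux_normsq (x y z : ℝ) (u v w : EuclideanSpace ℝ (Fin 4)) :
    ‖x • u + y • v + z • w‖ ^ 2 = x ^ 2 * ‖u‖ ^ 2 + y ^ 2 * ‖v‖ ^ 2 + z ^ 2 * ‖w‖ ^ 2
      + 2 * x * y * inner ℝ u v + 2 * x * z * inner ℝ u w + 2 * y * z * inner ℝ v w := by
  rw [norm_add_sq_real, norm_add_sq_real, inner_add_left]
  simp only [norm_smul, real_inner_smul_left, real_inner_smul_right, mul_pow,
    Real.norm_eq_abs, sq_abs]
  ring

theorem stmt5 (a b c ε : ℝ) (ha : 0 < a) (hab : a ≤ b) (hbc : b < c)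
    (htri : a + b > c) (hobt : a ^ 2 + b ^ 2 < c ^ 2)
    (Δ : ℝ)
    (hΔ : Δ = -a ^ 4 - b ^ 4 - c ^ 4 + 2 * a ^ 2 * b ^ 2 + 2 * b ^ 2 * c ^ 2 + 2 * c ^ 2 * a ^ 2)
    (hε : 0 < ε) (hεh : ε < Real.sqrt Δ / a)
    (A B P M : EuclideanSpace ℝ (Fin 4))
    (hAB : dist A B = ε)
    (hAM : dist A M = c) (hBM : dist B M = c) (hAP : dist A P = c) (hBP : dist B P = c)
    (hPM : dist P M = Real.sqrt ((Δ - a ^ 2 * ε ^ 2) / (b ^ 2 - (ε / 2) ^ 2))) :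
    ∃ N ∈ affineSpan ℝ ({A, B, P, M} : Set (EuclideanSpace ℝ (Fin 4))),
      dist N A = b ∧ dist N B = b ∧ dist N P = a ∧ dist N M = a := by
  have hΔpos : 0 < Δ := by
    by_contra h
    rw [Real.sqrt_eq_zero_of_nonpos (not_lt.mp h)] at hεh
    simp at hεh
    linarith
  have hb : 0 < b := lt_of_lt_of_le ha hab
  have h1 : a ^ 2 * ε ^ 2 < Δ := by
    rw [lt_div_iff₀ ha] at hεh
    have := Real.lt_sqrt (by positivity : 0 ≤ ε * a) |>.mp hεh
    nlinarith
  obtain ⟨k, hk⟩ : ∃ k, k = c ^ 2 - a ^ 2 - b ^ 2 := ⟨_, rfl⟩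
  have hkpos : 0 < k := by rw [hk]; linarith
  have hΔk : Δ = 4 * a ^ 2 * b ^ 2 - k ^ 2 := by rw [hΔ, hk]; ring
  obtain ⟨X, hX⟩ : ∃ X, X = b ^ 2 - (ε / 2) ^ 2 := ⟨_, rfl⟩
  have hXpos : 0 < X := by
    have h2 : 0 < a ^ 2 * (4 * X) := by rw [hX]; nlinarith [sq_nonneg k]
    have := pos_of_mul_pos_right h2 (by positivity)
    linarith
  rw [← hX] at hPM
  have hw2 : ‖P - M‖ ^ 2 = (Δ - a ^ 2 * ε ^ 2) / X := by
    rw [← dist_eq_norm, hPM, Real.sq_sqrt]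
    exact div_nonneg (by linarith) hXpos.le
  have hu : ‖A - M‖ ^ 2 = c ^ 2 := by rw [← dist_eq_norm, hAM]
  have hv : ‖B - M‖ ^ 2 = c ^ 2 := by rw [← dist_eq_norm, hBM]
  have huv : ‖(A - M) - (B - M)‖ ^ 2 = ε ^ 2 := by
    rw [sub_sub_sub_cancel_right, ← dist_eq_norm, hAB]
  have huw : ‖(A - M) - (P - M)‖ ^ 2 = c ^ 2 := by
    rw [sub_sub_sub_cancel_right, ← dist_eq_norm, hAP]
  have hvw : ‖(B - M) - (P - M)‖ ^ 2 = c ^ 2 := by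
    rw [sub_sub_sub_cancel_right, ← dist_eq_norm, hBP]
  rw [norm_sub_sq_real, hu, hv] at huv
  rw [norm_sub_sq_real, hu] at huw
  rw [norm_sub_sq_real, hv] at hvw
  have iuv : inner ℝ (A - M) (B - M) = c ^ 2 - ε ^ 2 / 2 := by linarith
  have iuw : inner ℝ (A - M) (P - M) = ‖P - M‖ ^ 2 / 2 := by linarith
  have ivw : inner ℝ (B - M) (P - M) = ‖P - M‖ ^ 2 / 2 := by linarith
  have key : ∀ x y z : ℝ, ‖x • (A - M) + y • (B - M) + z • (P - M)‖ ^ 2 =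
      (x + y) ^ 2 * c ^ 2 - x * y * ε ^ 2 + (z ^ 2 + (x + y) * z) * (4 * a ^ 2 - k ^ 2 / X) := by
    intro x y z
    have hL : ‖P - M‖ ^ 2 = 4 * a ^ 2 - k ^ 2 / X := by
      rw [hw2, hΔk]
      field_simp
      rw [hX]; ring
    rw [aux_normsq, iuv, iuw, ivw, hu, hv, hL]
    ring
  have hc : c ^ 2 = k + a ^ 2 + b ^ 2 := by rw [hk]; ring
  have he : ε ^ 2 = 4 * (b ^ 2 - X) := by rw [hX]; ring
  have hD : 2 * X + k ≠ 0 := by positivity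
  obtain ⟨t, ht⟩ : ∃ t, t = 2 * X / (2 * X + k) := ⟨_, rfl⟩
  have hmem : ∀ p ∈ ({A, B, P, M} : Set (EuclideanSpace ℝ (Fin 4))),
      p ∈ affineSpan ℝ ({A, B, P, M} : Set (EuclideanSpace ℝ (Fin 4))) :=
    fun p hp => mem_affineSpan ℝ hp
  have gen : ∀ (N Y : EuclideanSpace ℝ (Fin 4)) (r x y z : ℝ), 0 < r →
      N - Y = x • (A - M) + y • (B - M) + z • (P - M) →
      (x + y) ^ 2 * c ^ 2 - x * y * ε ^ 2 + (z ^ 2 + (x + y) * z) * (4 * a ^ 2 - k ^ 2 / X)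
        = r ^ 2 → dist N Y = r := by
    intro N Y r x y z hr h h'
    rw [← key, ← h, ← dist_eq_norm] at h'
    exact (pow_left_inj₀ dist_nonneg hr.le two_ne_zero).mp h'
  refine ⟨AffineMap.lineMap (midpoint ℝ A B) (midpoint ℝ P M) t,
    AffineMap.lineMap_mem _ (AffineMap.lineMap_mem _ (hmem _ (by simp)) (hmem _ (by simp)))
      (AffineMap.lineMap_mem _ (hmem _ (by simp)) (hmem _ (by simp))), ?_, ?_, ?_, ?_⟩
  · refine gen _ _ _ ((1 - t) / 2 - 1) ((1 - t) / 2) (t / 2) hb ?_ ?_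
    · rw [AffineMap.lineMap_apply_module, midpoint_eq_smul_add, midpoint_eq_smul_add, invOf_eq_inv]
      module
    · rw [hc, he, ht]; field_simp; ring
  · refine gen _ _ _ ((1 - t) / 2) ((1 - t) / 2 - 1) (t / 2) hb ?_ ?_
    · rw [AffineMap.lineMap_apply_module, midpoint_eq_smul_add, midpoint_eq_smul_add, invOf_eq_inv]
      module
    · rw [hc, he, ht]; field_simp; ring
  · refine gen _ _ _ ((1 - t) / 2) ((1 - t) / 2) (t / 2 - 1) ha ?_ ?_
    · rw [AffineMap.lineMap_apply_module, midpoint_eq_smul_add, midpoint_eq_smul_add, invOf_eq_inv]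
      module
    · rw [hc, he, ht]; field_simp; ring
  · refine gen _ _ _ ((1 - t) / 2) ((1 - t) / 2) (t / 2) ha ?_ ?_
    · rw [AffineMap.lineMap_apply_module, midpoint_eq_smul_add, midpoint_eq_smul_add, invOf_eq_inv]
      module
    · rw [hc, he, ht]; field_simp; ring
end

section
/- Let a tetrahedron T' in ℝⁿ (n ≥ 5) have a face F whose supporting height H exceeds the minimum circumradius ρ of the faces of T', where the face of circumradius ρ fits on a sphere of radius H. Then there exist points x₁, x₂, x₃, y₁, y₂, y₃, z ∈ ℝⁿ such that x₁x₂x₃ is congruent to F, each of the four tetrahedra y_i x₁ x₂ x₃ (i = 1,2,3) and z y₁ y₂ y₃ is congruent to T'. -/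
/-- Two labelled point families are congruent up to a relabelling permutation. -/
def IsCongruent {α : Type*} [MetricSpace α] {k : ℕ} (p q : Fin k → α) : Prop :=
  ∃ σ : Equiv.Perm (Fin k), ∀ i j, dist (p i) (p j) = dist (q (σ i)) (q (σ j))

/-- The circumradius of the face of a tetrahedron opposite vertex `i`. -/
noncomputable def faceCircumradius (n : ℕ)
    (S : Affine.Simplex ℝ (EuclideanSpace ℝ (Fin n)) 3) (i : Fin 4) : ℝ :=
  (S.face (fs := Finset.univ.erase i) (m := 2)
    (by simp [Finset.card_erase_of_mem])).circumradius

theorem congr_of_cons {α : Type*} [MetricSpace α] (i : Fin 4) (a : α) (b : Fin 3 → α)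
    (q : Fin 4 → α) (h1 : ∀ k, dist a (b k) = dist (q i) (q (i.succAbove k)))
    (h2 : ∀ k l, dist (b k) (b l) = dist (q (i.succAbove k)) (q (i.succAbove l))) :
    IsCongruent ![a, b 0, b 1, b 2] q := by
  refine ⟨(finSuccEquiv' 0).trans (finSuccEquiv' i).symm, ?_⟩
  have e0 : ((finSuccEquiv' 0).trans (finSuccEquiv' i).symm) (0 : Fin 4) = i := by simp
  have es : ∀ k : Fin 3, ((finSuccEquiv' 0).trans (finSuccEquiv' i).symm) k.succ
      = i.succAbove k := by
    intro k
    rw [Equiv.trans_apply, ← Fin.succAbove_zero, finSuccEquiv'_succAbove,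
      finSuccEquiv'_symm_some]
  have hb : ![a, b 0, b 1, b 2] = (Fin.cons a b : Fin 4 → α) := by
    funext k; fin_cases k <;> rfl
  rw [hb]
  intro k l
  refine Fin.cases ?_ (fun k => ?_) k <;> refine Fin.cases ?_ (fun l => ?_) l
  · simp
  · rw [e0, es, Fin.cons_zero, Fin.cons_succ, h1]
  · rw [e0, es, Fin.cons_zero, Fin.cons_succ, dist_comm, h1, dist_comm]
  · rw [es, es, Fin.cons_succ, Fin.cons_succ, h2]

theorem exists_iso {E : Type*} [NormedAddCommGroup E] [InnerProductSpace ℝ E]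
    [FiniteDimensional ℝ E] (D W : Submodule ℝ E) (hD : Module.finrank ℝ D = 2)
    (hW : 3 ≤ Module.finrank ℝ W) :
    ∃ (Φ : E →ₗᵢ[ℝ] E) (u : E), u ∈ W ∧ ‖u‖ = 1 ∧
      ∀ v ∈ D, Φ v ∈ W ∧ inner ℝ (Φ v) u = 0 := by
  let d := stdOrthonormalBasis ℝ D
  let b := stdOrthonormalBasis ℝ W
  let g : Fin (Module.finrank ℝ D) → Fin (Module.finrank ℝ W) := Fin.castLE (by omega)
  have hg : Function.Injective g := Fin.castLE_injective _
  let u : W := b ⟨2, by omega⟩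
  let f : D →ₗ[ℝ] W := d.toBasis.constr ℝ (fun k => b (g k))
  have hf : ∀ k, f (d k) = b (g k) := by
    intro k
    rw [← d.coe_toBasis]
    exact d.toBasis.constr_basis ℝ (fun k => b (g k)) k
  have hfo : Orthonormal ℝ (f ∘ d.toBasis) := by
    have : (f ∘ d.toBasis) = (b ∘ g) := by funext k; simp [hf]
    rw [this]
    exact b.orthonormal.comp g hg
  let L : D →ₗᵢ[ℝ] W := f.isometryOfOrthonormal (v := d.toBasis)
    (by simp) hfo
  have hL : ∀ w, L w = f w := fun w => rfl
  have hz : ∀ w, inner ℝ u (L w) = 0 := by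
    have : (innerₛₗ ℝ u).comp f = 0 := by
      apply d.toBasis.ext
      intro k
      have hne : (⟨2, by omega⟩ : Fin (Module.finrank ℝ W)) ≠ g k := by
        intro h
        have h2 : 2 = k.val := congrArg Fin.val h
        have := k.2
        omega
      have h0 : inner ℝ u (f (d k)) = 0 := by
        rw [hf]
        exact b.orthonormal.2 hne
      simpa using h0
    intro w
    exact LinearMap.congr_fun this w
  let M : D →ₗᵢ[ℝ] E := W.subtypeₗᵢ.comp L
  refine ⟨M.extend, u, u.2, ?_, ?_⟩
  · exact b.orthonormal.1 ⟨2, by omega⟩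
  · intro v hv
    have h : M.extend v = (L ⟨v, hv⟩ : E) := M.extend_apply ⟨v, hv⟩
    rw [h]
    refine ⟨(L ⟨v, hv⟩).2, ?_⟩
    rw [real_inner_comm]
    exact hz ⟨v, hv⟩

theorem stmt18 (n : ℕ) (hn : 5 ≤ n)
    (S : Affine.Simplex ℝ (EuclideanSpace ℝ (Fin n)) 3)
    (hHρ : (Finset.univ.inf' Finset.univ_nonempty fun i => faceCircumradius n S i) <
      Metric.infDist (S.points 3)
        ((affineSpan ℝ (S.points '' {0, 1, 2}) : AffineSubspace ℝ (EuclideanSpace ℝ (Fin n))) :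
          Set (EuclideanSpace ℝ (Fin n)))) :
    ∃ (x y : Fin 3 → EuclideanSpace ℝ (Fin n)) (z : EuclideanSpace ℝ (Fin n)),
      (∀ i j : Fin 3, dist (x i) (x j) = dist (S.points i.castSucc) (S.points j.castSucc)) ∧
      (∀ i : Fin 3, IsCongruent ![y i, x 0, x 1, x 2] S.points) ∧
      IsCongruent ![z, y 0, y 1, y 2] S.points := by
  classical
  obtain ⟨i, -, hi⟩ := Finset.exists_mem_eq_inf' Finset.univ_nonempty
    (fun i => faceCircumradius n S i)
  rw [hi] at hHρ
  set A : AffineSubspace ℝ (EuclideanSpace ℝ (Fin n)) :=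
    affineSpan ℝ (S.points '' {0, 1, 2}) with hA
  have hmem : ∀ k : Fin 3, S.points k.castSucc ∈ A := by
    intro k
    apply subset_affineSpan
    refine ⟨k.castSucc, ?_, rfl⟩
    fin_cases k <;> simp
  have : Nonempty A := ⟨⟨_, hmem 0⟩⟩
  have hAd : Module.finrank ℝ A.direction = 2 := by
    have h := S.independent.finrank_vectorSpan_image_finset
      (s := {0, 1, 2}) (n := 2) (by decide)
    rw [hA, direction_affineSpan]
    have hs : (({0, 1, 2} : Finset (Fin 4)) : Set (Fin 4)) = {0, 1, 2} := by simp
    rw [Finset.coe_image, hs] at h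
    exact h
  have hWd : 3 ≤ Module.finrank ℝ A.directionᗮ := by
    have := A.direction.finrank_add_finrank_orthogonal
    rw [finrank_euclideanSpace_fin] at this
    omega
  obtain ⟨F, hF⟩ : ∃ F, F = S.face (fs := Finset.univ.erase i) (m := 2)
    (by simp [Finset.card_erase_of_mem]) := ⟨_, rfl⟩
  have hFr : Set.range F.points = S.points '' ((Finset.univ.erase i : Finset (Fin 4)) : Set (Fin 4)) := by
    rw [hF, Affine.Simplex.range_face_points]
  have hρ : faceCircumradius n S i = F.circumradius := by rw [hF]; rfl
  rw [hρ] at hHρ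
  have hDd : Module.finrank ℝ (affineSpan ℝ (Set.range F.points)).direction = 2 := by
    rw [direction_affineSpan]
    exact F.independent.finrank_vectorSpan (by simp)
  obtain ⟨Φ, u, huW, hu1, hΦ⟩ := exists_iso _ _ hDd hWd
  have hpF : ∀ k, S.points (i.succAbove k) ∈ Set.range F.points := by
    intro k
    rw [hFr]
    exact ⟨_, by simp [Fin.succAbove_ne], rfl⟩
  set c := F.circumcenter with hc
  have hpc : ∀ k, S.points (i.succAbove k) - c ∈
      (affineSpan ℝ (Set.range F.points)).direction := by
    intro k
    exact AffineSubspace.vsub_mem_direction (subset_affineSpan _ _ (hpF k))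
      F.circumcenter_mem_affineSpan
  have hpr : ∀ k, ‖S.points (i.succAbove k) - c‖ = F.circumradius := by
    intro k
    obtain ⟨j, hj⟩ := hpF k
    rw [← hj, ← dist_eq_norm]
    exact F.dist_circumcenter_eq_circumradius j
  set f : EuclideanSpace ℝ (Fin n) :=
    (EuclideanGeometry.orthogonalProjection A (S.points 3) : EuclideanSpace ℝ (Fin n)) with hf
  have hfA : f ∈ A := EuclideanGeometry.orthogonalProjection_mem _
  have hfo : S.points 3 - f ∈ A.directionᗮ :=
    EuclideanGeometry.vsub_orthogonalProjection_mem_direction_orthogonal A _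
  have hH : Metric.infDist (S.points 3) (A : Set (EuclideanSpace ℝ (Fin n)))
      = ‖S.points 3 - f‖ := by
    rw [← EuclideanGeometry.dist_orthogonalProjection_eq_infDist, dist_eq_norm, norm_sub_rev]
  rw [hH] at hHρ
  have hρ0 : 0 ≤ F.circumradius := F.circumradius_nonneg
  set t := Real.sqrt (‖S.points 3 - f‖ ^ 2 - F.circumradius ^ 2) with ht
  have ht2 : t ^ 2 = ‖S.points 3 - f‖ ^ 2 - F.circumradius ^ 2 :=
    Real.sq_sqrt (by nlinarith)
  let G : EuclideanSpace ℝ (Fin n) → EuclideanSpace ℝ (Fin n) :=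
    fun p => f + (Φ (p - c) + t • u)
  have hG : ∀ p q, dist (G p) (G q) = dist p q := by
    intro p q
    simp only [G, dist_add_left, dist_add_right, Φ.dist_map, dist_sub_right]
  have hpyth : ∀ w ∈ A.directionᗮ, ∀ k : Fin 3,
      dist (f + w) (S.points k.castSucc) ^ 2 = ‖w‖ ^ 2 + ‖f - S.points k.castSucc‖ ^ 2 := by
    intro w hw k
    have h0 : inner ℝ w (f - S.points k.castSucc) = 0 :=
      Submodule.inner_left_of_mem_orthogonal
        (AffineSubspace.vsub_mem_direction hfA (hmem k)) hw
    rw [dist_eq_norm, add_sub_right_comm, add_comm, norm_add_sq_real, h0]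
    ring
  refine ⟨fun k => S.points k.castSucc, fun k => G (S.points (i.succAbove k)), G (S.points i),
    fun _ _ => rfl, ?_, ?_⟩
  · intro k
    have h3 : ∀ l : Fin 3, (3 : Fin 4).succAbove l = l.castSucc := by decide
    refine congr_of_cons 3 _ (fun k : Fin 3 => S.points k.castSucc) _ ?_ ?_
    · intro l
      rw [h3]
      have hw : Φ (S.points (i.succAbove k) - c) + t • u ∈ A.directionᗮ :=
        Submodule.add_mem _ (hΦ _ (hpc k)).1 (Submodule.smul_mem _ _ huW)
      have e1 := hpyth _ hw l
      have e2 := hpyth _ hfo l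
      rw [add_sub_cancel] at e2
      have e3 : ‖Φ (S.points (i.succAbove k) - c) + t • u‖ ^ 2 = ‖S.points 3 - f‖ ^ 2 := by
        rw [norm_add_sq_real, inner_smul_right, (hΦ _ (hpc k)).2, Φ.norm_map, hpr, norm_smul,
          hu1, mul_one, Real.norm_eq_abs, sq_abs, ht2]
        ring
      rw [e3, ← e2] at e1
      exact (sq_eq_sq₀ dist_nonneg dist_nonneg).1 e1
    · intro l m
      rw [h3, h3]
  · exact congr_of_cons i _ (fun k => G (S.points (i.succAbove k))) _
      (fun _ => hG _ _) (fun _ _ => hG _ _)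
end
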